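/- arXiv:2011.09674 — 3 statements merged into one kernel-verified Lean document; each statement's English description precedes it below -/
import Mathlib

section
/- In the exact-data case, the residuals of the LMK iteration are square summable with the quantitative bound Σ_{k=0}^∞ ‖F_{[k]}(x_k) − y_{[k]}‖² ≤ α (2 q (q − η))^{-1} ‖x₀ − x*‖² < ∞. -/
open Metric Filter

open scoped InnerProductSpace

section LevenbergMarquardtStep

variable {X Y : Type*} [NormedAddCommGroup X] [InnerProductSpace ℝ X] [CompleteSpace X]
  [NormedAddCommGroup Y] [InnerProductSpace ℝ Y] [CompleteSpace Y]

/-- The linearized residual of a Levenberg-Marquardt step is at least `q` times the residual. -/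
theorem mul_norm_le_norm_linearized_residual {A : X →L[ℝ] Y} {h : X} {r : Y} {α C q : ℝ}
    (hα : 0 < α) (hA : ‖A‖ ≤ C) (hq : C ^ 2 * q ≤ α * (1 - q))
    (hh : A.adjoint (A h) + α • h = A.adjoint r) :
    q * ‖r‖ ≤ ‖A h - r‖ := by
  have hC : 0 ≤ C := (norm_nonneg A).trans hA
  have h_smul : α • h = -A.adjoint (A h - r) := by
    rw [map_sub, ← hh]; abel
  have h_res : α • r = -(α • (A h - r) + A (A.adjoint (A h - r))) := by
    have := congrArg A h_smul
    rw [map_smul, map_neg] at this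
    rw [smul_sub, this]; abel
  have h_adj : ‖A (A.adjoint (A h - r))‖ ≤ C * (C * ‖A h - r‖) := by
    refine A.le_of_opNorm_le_of_le hA (ContinuousLinearMap.le_of_opNorm_le _ ?_ _)
    rwa [LinearIsometryEquiv.norm_map]
  have h_norm : α * ‖r‖ ≤ α * ‖A h - r‖ + C * (C * ‖A h - r‖) := by
    calc α * ‖r‖ = ‖α • r‖ := by rw [norm_smul, Real.norm_of_nonneg hα.le]
      _ ≤ ‖α • (A h - r)‖ + ‖A (A.adjoint (A h - r))‖ := by
          rw [h_res, norm_neg]; exact norm_add_le _ _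
      _ ≤ _ := by rw [norm_smul, Real.norm_of_nonneg hα.le]; gcongr
  have hpos : 0 < α + C ^ 2 := by positivity
  refine le_of_mul_le_mul_left ?_ hpos
  nlinarith [mul_le_mul_of_nonneg_right hq (norm_nonneg r)]

/-- Energy decrease of one Levenberg-Marquardt step `h`, where `e` is the vector from the current
iterate to a solution and `r` is the residual. -/
theorem norm_sub_sq_add_le_of_levenbergMarquardt {A : X →L[ℝ] Y} {h e : X} {r : Y}
    {α C q η : ℝ} (hα : 0 < α) (hA : ‖A‖ ≤ C) (hq : C ^ 2 * q ≤ α * (1 - q))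
    (hηq : η < q) (hh : A.adjoint (A h) + α • h = A.adjoint r)
    (he : ‖r - A e‖ ≤ η * ‖r‖) :
    α * ‖h - e‖ ^ 2 + 2 * q * (q - η) * ‖r‖ ^ 2 ≤ α * ‖e‖ ^ 2 := by
  have hB := mul_norm_le_norm_linearized_residual hα hA hq hh
  have h_inner (v : X) : α * ⟪h, v⟫_ℝ = -⟪A h - r, A v⟫_ℝ := by
    have h_smul : α • h = -A.adjoint (A h - r) := by
      rw [map_sub, ← hh]; abel
    rw [← real_inner_smul_left, h_smul, inner_neg_left, ContinuousLinearMap.adjoint_inner_left]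
  have h_cross : -(‖A h - r‖ * (η * ‖r‖)) ≤ ⟪A h - r, r - A e⟫_ℝ := by
    have h₁ := (abs_le.mp (abs_real_inner_le_norm (A h - r) (r - A e))).1
    have h₂ := mul_le_mul_of_nonneg_left he (norm_nonneg (A h - r))
    linarith
  have h_diff : α * ‖h - e‖ ^ 2 = α * ‖e‖ ^ 2 - α * ‖h‖ ^ 2
      - 2 * ‖A h - r‖ ^ 2 - 2 * ⟪A h - r, r - A e⟫_ℝ := by
    have h₁ := h_inner h
    have h₂ := h_inner e
    have h₃ : ⟪A h - r, A h⟫_ℝ = ‖A h - r‖ ^ 2 + ⟪A h - r, r⟫_ℝ := by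
      rw [← real_inner_self_eq_norm_sq, ← inner_add_right, sub_add_cancel]
    rw [real_inner_self_eq_norm_sq] at h₁
    rw [norm_sub_sq_real, inner_sub_right]
    linear_combination 2 * h₁ - 2 * h₂ - 2 * h₃
  have h_mono : q * ‖r‖ * ((q - η) * ‖r‖) ≤ ‖A h - r‖ * (‖A h - r‖ - η * ‖r‖) := by
    apply mul_le_mul hB (by linarith) _ (norm_nonneg _)
    exact mul_nonneg (by linarith) (norm_nonneg _)
  nlinarith [mul_nonneg hα.le (sq_nonneg ‖h‖)]

end LevenbergMarquardtStep

/-- exact data: the residuals of the LMK iteration are square summable with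
`∑ₖ ‖F_{[k]}(x_k) - y_{[k]}‖² ≤ α (2 q (q - η))⁻¹ ‖x₀ - x*‖² < ∞`. -/
theorem stmt_8
    {X Y : Type*} [NormedAddCommGroup X] [InnerProductSpace ℝ X] [CompleteSpace X]
    [NormedAddCommGroup Y] [InnerProductSpace ℝ Y] [CompleteSpace Y]
    (N : ℕ) (hN : 1 ≤ N)
    (F : ℕ → X → Y) (F' : ℕ → X → (X →L[ℝ] Y))
    (hFcont : ∀ i < N, Continuous (F i)) (hF'cont : ∀ i < N, Continuous (F' i))
    (x₀ xstar : X) (ρ C η : ℝ) (hρ : 0 < ρ) (hC : 0 < C) (hη0 : 0 ≤ η) (hη1 : η < 1)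
    (hA1 : ∀ i < N, ∀ x ∈ closedBall x₀ ρ, ‖F' i x‖ ≤ C)
    (hA2 : ∀ i < N, ∀ x ∈ closedBall x₀ ρ, ∀ x' ∈ closedBall x₀ ρ,
        ‖F i x' - F i x - F' i x (x' - x)‖ ≤ η * ‖F i x' - F i x‖)
    (y : ℕ → Y) (hA3 : xstar ∈ closedBall x₀ (ρ / 2)) (hsol : ∀ i < N, F i xstar = y i)
    (q α τ : ℝ) (hq0 : 0 < q) (hq1 : q < 1)
    (hα : C ^ 2 * q / (1 - q) < α)
    (hτ : (1 + η) / (1 - η) < τ) (hqτ : η + (1 + η) / τ < q)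
    (x h : ℕ → X)
    (hx0 : x 0 = x₀)
    (hh : ∀ k, ContinuousLinearMap.adjoint (F' (k % N) (x k)) (F' (k % N) (x k) (h k))
        + α • h k
        = ContinuousLinearMap.adjoint (F' (k % N) (x k)) (y (k % N) - F (k % N) (x k)))
    (hrec : ∀ k, x (k + 1) = x k + h k)
    :
    Summable (fun k : ℕ => ‖F (k % N) (x k) - y (k % N)‖ ^ 2) ∧
      ∑' k : ℕ, ‖F (k % N) (x k) - y (k % N)‖ ^ 2 ≤
        α * (2 * q * (q - η))⁻¹ * ‖x₀ - xstar‖ ^ 2 := by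
  have hηq : η < q := by
    have hτ0 : 0 < τ := lt_trans (div_pos (by linarith) (by linarith)) hτ
    have : 0 < (1 + η) / τ := div_pos (by linarith) hτ0
    linarith
  have hα0 : 0 < α := lt_of_le_of_lt (div_nonneg (by positivity) (by linarith)) hα
  have hαq : C ^ 2 * q ≤ α * (1 - q) := ((div_lt_iff₀ (by linarith)).mp hα).le
  have hstar : xstar ∈ closedBall x₀ ρ := closedBall_subset_closedBall (by linarith) hA3
  have h_start : ‖xstar - x₀‖ ≤ ρ / 2 := by rwa [mem_closedBall, dist_eq_norm] at hA3
  have h_step (k : ℕ) (hk : ‖xstar - x k‖ ≤ ρ / 2) :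
      α * ‖xstar - x (k + 1)‖ ^ 2 + 2 * q * (q - η) * ‖F (k % N) (x k) - y (k % N)‖ ^ 2
        ≤ α * ‖xstar - x k‖ ^ 2 := by
    have hkN : k % N < N := Nat.mod_lt _ hN
    have hxk : x k ∈ closedBall x₀ ρ := by
      rw [mem_closedBall, dist_eq_norm]
      have := norm_sub_le_norm_sub_add_norm_sub (x k) xstar x₀
      rw [norm_sub_rev (x k) xstar] at this
      linarith
    have h_cone := hA2 _ hkN _ hxk _ hstar
    rw [hsol _ hkN] at h_cone
    have := norm_sub_sq_add_le_of_levenbergMarquardt hα0 (hA1 _ hkN _ hxk) hαq hηq (hh k)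
      h_cone
    rwa [show h k - (xstar - x k) = x (k + 1) - xstar by rw [hrec]; abel,
      norm_sub_rev (x (k + 1)), norm_sub_rev (y (k % N))] at this
  have hc : 0 < 2 * q * (q - η) := mul_pos (by linarith) (by linarith)
  have h_near (k : ℕ) : ‖xstar - x k‖ ≤ ρ / 2 := by
    induction k with
    | zero => rwa [hx0]
    | succ k ih =>
      have h_sq : α * ‖xstar - x (k + 1)‖ ^ 2 ≤ α * ‖xstar - x k‖ ^ 2 := by
        have := h_step k ih
        have : 0 ≤ 2 * q * (q - η) * ‖F (k % N) (x k) - y (k % N)‖ ^ 2 := by positivity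
        linarith
      exact (pow_le_pow_iff_left₀ (norm_nonneg _) (norm_nonneg _) two_ne_zero |>.mp
        (le_of_mul_le_mul_left h_sq hα0)).trans ih
  have h_partial (n : ℕ) :
      2 * q * (q - η) * ∑ k ∈ Finset.range n, ‖F (k % N) (x k) - y (k % N)‖ ^ 2
        + α * ‖xstar - x n‖ ^ 2 ≤ α * ‖x₀ - xstar‖ ^ 2 := by
    induction n with
    | zero => simp [hx0, norm_sub_rev]
    | succ n ih =>
      rw [Finset.sum_range_succ, mul_add]
      linarith [h_step n (h_near n)]
  have h_bound (n : ℕ) : ∑ k ∈ Finset.range n, ‖F (k % N) (x k) - y (k % N)‖ ^ 2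
      ≤ α * (2 * q * (q - η))⁻¹ * ‖x₀ - xstar‖ ^ 2 := by
    rw [mul_right_comm, ← div_eq_mul_inv, le_div_iff₀' hc]
    have : 0 ≤ α * ‖xstar - x n‖ ^ 2 := by positivity
    linarith [h_partial n]
  exact ⟨summable_of_sum_range_le (fun _ => sq_nonneg _) h_bound,
    Real.tsum_le_of_sum_range_le (fun _ => sq_nonneg _) h_bound⟩
end

section
/- Consider the exact-data case. Let x† ∈ B_{ρ/2}(x₀) satisfy F_i(x†) = y_i for all i, set N† := ⋂_{i=0}^{N−1} ker F_i'(x†), and assume the kernel condition N† ⊆ ⋂_{i=0}^{N−1} ker F_i'(x) for all x ∈ B_ρ(x₀). Then every LMK iterate satisfies x_k − x₀ ∈ (N†)^⊥; consequently, if x† is the only solution of the system in B_{ρ/2}(x₀) ∩ (x₀ + (N†)^⊥), then x_k → x† as k → ∞. -/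
open Metric Filter

section LevenbergMarquardtStep

variable {X Y : Type*} [NormedAddCommGroup X] [InnerProductSpace ℝ X] [CompleteSpace X]
  [NormedAddCommGroup Y] [InnerProductSpace ℝ Y] [CompleteSpace Y]
  {A : X →L[ℝ] Y} {h : X} {w : Y} {α : ℝ}

/-- A Levenberg–Marquardt step tested against a vector. -/
theorem lm_step_inner
    (hh : ContinuousLinearMap.adjoint A (A h) + α • h = ContinuousLinearMap.adjoint A w) (v : X) :
    α * inner ℝ h v = inner ℝ (w - A h) (A v) := by
  have h1 : α • h = ContinuousLinearMap.adjoint A (w - A h) := by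
    rw [map_sub, ← hh]; abel
  rw [← real_inner_smul_left, h1, ContinuousLinearMap.adjoint_inner_left]

theorem lm_step_inner_residual
    (hh : ContinuousLinearMap.adjoint A (A h) + α • h = ContinuousLinearMap.adjoint A w) :
    inner ℝ (w - A h) w = ‖w - A h‖ ^ 2 + α * ‖h‖ ^ 2 := by
  have h1 := lm_step_inner hh h
  rw [real_inner_self_eq_norm_sq] at h1
  rw [h1, ← real_inner_self_eq_norm_sq, ← inner_add_right]
  congr 1; abel

theorem lm_step_norm_linearized_le (hα : 0 ≤ α)
    (hh : ContinuousLinearMap.adjoint A (A h) + α • h = ContinuousLinearMap.adjoint A w) :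
    ‖w - A h‖ ≤ ‖w‖ := by
  have h1 := lm_step_inner_residual hh
  have h2 := real_inner_le_norm (w - A h) w
  have h3 : 0 ≤ α * ‖h‖ ^ 2 := by positivity
  by_contra! h4
  nlinarith [norm_nonneg w]

theorem lm_step_norm_le {C : ℝ} (hA : ‖A‖ ≤ C)
    (hh : ContinuousLinearMap.adjoint A (A h) + α • h = ContinuousLinearMap.adjoint A w) :
    α * ‖h‖ ≤ C * ‖w - A h‖ := by
  rcases eq_or_ne h 0 with rfl | hne
  · have : 0 ≤ C := (norm_nonneg A).trans hA
    simp only [norm_zero, mul_zero]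
    positivity
  have h1 := lm_step_inner hh h
  rw [real_inner_self_eq_norm_sq] at h1
  have h2 := real_inner_le_norm (w - A h) (A h)
  have h3 := A.le_of_opNorm_le hA h
  have h4 : ‖w - A h‖ * ‖A h‖ ≤ ‖w - A h‖ * (C * ‖h‖) := by gcongr
  have h5 : 0 < ‖h‖ := norm_pos_iff.2 hne
  refine le_of_mul_le_mul_right ?_ h5
  nlinarith

theorem lm_step_mul_norm_le_linearized {C q : ℝ} (hC : 0 ≤ C) (hα : 0 < α) (hq : 0 < q)
    (hq1 : q < 1)
    (hCα : C ^ 2 * q / (1 - q) < α) (hA : ‖A‖ ≤ C)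
    (hh : ContinuousLinearMap.adjoint A (A h) + α • h = ContinuousLinearMap.adjoint A w) :
    q * ‖w‖ ≤ ‖w - A h‖ := by
  have h1 := lm_step_norm_le hA hh
  have h2 := A.le_of_opNorm_le hA h
  have h3 : ‖w‖ ≤ ‖w - A h‖ + ‖A h‖ := by simpa using norm_add_le (w - A h) (A h)
  have h4 : C ^ 2 * q < α * (1 - q) := (div_lt_iff₀ (by linarith)).1 hCα
  have h5 : α * ‖A h‖ ≤ C ^ 2 * ‖w - A h‖ := by
    calc α * ‖A h‖ ≤ α * (C * ‖h‖) := by gcongr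
      _ = C * (α * ‖h‖) := by ring
      _ ≤ C * (C * ‖w - A h‖) := by gcongr
      _ = _ := by ring
  have h6 : C ^ 2 * q * ‖w - A h‖ ≤ α * (1 - q) * ‖w - A h‖ := by gcongr
  refine le_of_mul_le_mul_left ?_ hα
  calc α * (q * ‖w‖) = α * q * ‖w‖ := by ring
    _ ≤ α * q * (‖w - A h‖ + ‖A h‖) := by gcongr
    _ = α * q * ‖w - A h‖ + q * (α * ‖A h‖) := by ring
    _ ≤ α * q * ‖w - A h‖ + q * (C ^ 2 * ‖w - A h‖) := by gcongr
    _ ≤ _ := by linarith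

/-- Decrease of the squared error in a Levenberg–Marquardt step. -/
theorem lm_step_error_decrease {C q η : ℝ} (hC : 0 ≤ C) (hα : 0 < α) (hq : 0 < q) (hq1 : q < 1)
    (hCα : C ^ 2 * q / (1 - q) < α) (hA : ‖A‖ ≤ C) (hηq : η ≤ q)
    (hh : ContinuousLinearMap.adjoint A (A h) + α • h = ContinuousLinearMap.adjoint A w)
    {e : X} (he : ‖w + A e‖ ≤ η * ‖w‖) :
    α * ‖e + h‖ ^ 2 + 2 * (q - η) * q * ‖w‖ ^ 2 ≤ α * ‖e‖ ^ 2 := by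
  have h1 := lm_step_inner hh e
  have h2 := lm_step_inner_residual hh
  have h3 := lm_step_mul_norm_le_linearized hC hα hq hq1 hCα hA hh
  have h4 : inner ℝ (w - A h) (w + A e) ≤ ‖w - A h‖ * (η * ‖w‖) :=
    (real_inner_le_norm _ _).trans (by gcongr)
  rw [inner_add_right] at h4
  have h5 : ‖e + h‖ ^ 2 = ‖e‖ ^ 2 + 2 * inner ℝ h e + ‖h‖ ^ 2 := by
    rw [norm_add_sq_real, real_inner_comm]
  have h6 : 0 ≤ α * ‖h‖ ^ 2 := by positivity
  have h7 : ‖w - A h‖ * (q * ‖w‖) ≤ ‖w - A h‖ * ‖w - A h‖ := by gcongr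
  have h8 : (q - η) * (q * ‖w‖ * ‖w‖) ≤ (q - η) * (‖w - A h‖ * ‖w‖) := by
    have : 0 ≤ q - η := by linarith
    gcongr
  rw [h5]
  nlinarith

end LevenbergMarquardtStep

theorem cauchySeq_of_norm_sub_sq_le {E : Type*} [SeminormedAddCommGroup E] {z : ℕ → E}
    {G : ℕ → ℝ} (hG : CauchySeq G) (h : ∀ k l, k ≤ l → ‖z l - z k‖ ^ 2 ≤ G k - G l) :
    CauchySeq z := by
  rw [Metric.cauchySeq_iff'] at hG ⊢
  intro ε hε
  obtain ⟨n, hn⟩ := hG (ε ^ 2) (by positivity)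
  refine ⟨n, fun l hl => ?_⟩
  have h1 := hn l hl
  have h2 := h n l hl
  rw [Real.dist_eq, abs_lt] at h1
  rw [dist_eq_norm]
  exact lt_of_pow_lt_pow_left₀ 2 hε.le (by linarith)

/-- A sequence with monotone error is Cauchy if its increments, tested against the errors,
are controlled by a square-summable sequence. -/
theorem cauchySeq_of_antitone_of_inner_le {X : Type*} [NormedAddCommGroup X]
    [InnerProductSpace ℝ X] {z : ℕ → X} {p : X} {R : ℕ → ℝ} {K : ℝ} (hK : 0 ≤ K)
    (hR : ∀ m, 0 ≤ R m) (hsum : Summable fun m => R m ^ 2)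
    (hanti : Antitone fun m => ‖z m - p‖)
    (hinner : ∀ m n, |inner ℝ (z (m + 1) - z m) (z n - p)| ≤ K * R m * (R m + R n)) :
    CauchySeq z := by
  set S : ℕ → ℝ := fun n => ∑ m ∈ Finset.range n, R m ^ 2 with hS
  have hSc : CauchySeq S := hsum.hasSum.tendsto_sum_nat.cauchySeq
  have hanti2 : Antitone fun m => ‖z m - p‖ ^ 2 := fun a b hab =>
    pow_le_pow_left₀ (norm_nonneg _) (hanti hab) 2
  have hεc : CauchySeq fun m => ‖z m - p‖ ^ 2 :=
    (tendsto_atTop_ciInf hanti2 ⟨0, by rintro _ ⟨m, rfl⟩; positivity⟩).cauchySeq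
  have key : ∀ n a b, a ≤ b → (∀ m, a ≤ m → m < b → R n ≤ R m) →
      |inner ℝ (z b - z a) (z n - p)| ≤ 2 * K * (S b - S a) := by
    intro n a b hab
    induction b, hab using Nat.le_induction with
    | base => intro _; simp
    | succ b hab ih =>
      intro hmin
      have h1 := ih fun m hm hmb => hmin m hm (by omega)
      have h2 := hinner b n
      have h3 : R n ≤ R b := hmin b hab (by omega)
      have h4 : S (b + 1) = S b + R b ^ 2 := Finset.sum_range_succ _ _
      have h5 : inner ℝ (z (b + 1) - z a) (z n - p)
          = inner ℝ (z (b + 1) - z b) (z n - p) + inner ℝ (z b - z a) (z n - p) := by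
        rw [← inner_add_left]; congr 1; abel
      have h6 : K * R b * (R b + R n) ≤ K * R b * (R b + R b) := by
        have := hR b
        gcongr
      rw [h5, h4]
      refine (abs_add_le _ _).trans ?_
      nlinarith
  refine cauchySeq_of_norm_sub_sq_le (G := fun k => 2 * ‖z k - p‖ ^ 2 - 8 * K * S k) ?_ ?_
  · obtain ⟨s, hs⟩ := cauchySeq_tendsto_of_complete hSc
    obtain ⟨t, ht⟩ := cauchySeq_tendsto_of_complete hεc
    exact ((ht.const_mul 2).sub (hs.const_mul (8 * K))).cauchySeq
  intro k l hkl
  obtain ⟨n, hn, hmin⟩ := Finset.exists_min_image (Finset.Icc k l) R ⟨k, by simp [hkl]⟩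
  rw [Finset.mem_Icc] at hn
  have h1 := (abs_le.1 (key n k n hn.1 fun m hm hmn =>
    hmin m (Finset.mem_Icc.2 ⟨hm, by omega⟩))).2
  have h2 := (abs_le.1 (key n n l hn.2 fun m hm hml =>
    hmin m (Finset.mem_Icc.2 ⟨by omega, by omega⟩))).1
  have h3 : ‖z k - p‖ ^ 2
      = ‖z n - p‖ ^ 2 - 2 * inner ℝ (z n - z k) (z n - p) + ‖z n - z k‖ ^ 2 := by
    rw [real_inner_comm, ← norm_sub_sq_real]; congr 2; abel
  have h4 : ‖z l - p‖ ^ 2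
      = ‖z n - p‖ ^ 2 + 2 * inner ℝ (z l - z n) (z n - p) + ‖z l - z n‖ ^ 2 := by
    rw [real_inner_comm, ← norm_add_sq_real]; congr 2; abel
  have h5 : ‖z l - z k‖ ^ 2 ≤ 2 * ‖z l - z n‖ ^ 2 + 2 * ‖z n - z k‖ ^ 2 := by
    have h6 : ‖z l - z k‖ ≤ ‖z l - z n‖ + ‖z n - z k‖ := by
      simpa using norm_add_le (z l - z n) (z n - z k)
    nlinarith [sq_nonneg (‖z l - z n‖ - ‖z n - z k‖), norm_nonneg (z l - z k)]
  have h6 := hanti2 hn.2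
  simp only at h6 ⊢
  nlinarith

/-- exact data, kernel condition. With `N† = ⋂ᵢ ker F'ᵢ(x†)` (given as the
submodule `Kdag`), if `N† ⊆ ⋂ᵢ ker F'ᵢ(x)` for all `x ∈ B_ρ(x₀)`, then every LMK iterate
satisfies `x_k - x₀ ∈ (N†)^⊥`; consequently, if `x†` is the only solution in
`B_{ρ/2}(x₀) ∩ (x₀ + (N†)^⊥)`, then `x_k → x†`. -/
theorem stmt_13
    {X Y : Type*} [NormedAddCommGroup X] [InnerProductSpace ℝ X] [CompleteSpace X]
    [NormedAddCommGroup Y] [InnerProductSpace ℝ Y] [CompleteSpace Y]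
    (N : ℕ) (hN : 1 ≤ N)
    (F : ℕ → X → Y) (F' : ℕ → X → (X →L[ℝ] Y))
    (hFcont : ∀ i < N, Continuous (F i)) (hF'cont : ∀ i < N, Continuous (F' i))
    (x₀ xstar : X) (ρ C η : ℝ) (hρ : 0 < ρ) (hC : 0 < C) (hη0 : 0 ≤ η) (hη1 : η < 1)
    (hA1 : ∀ i < N, ∀ x ∈ closedBall x₀ ρ, ‖F' i x‖ ≤ C)
    (hA2 : ∀ i < N, ∀ x ∈ closedBall x₀ ρ, ∀ x' ∈ closedBall x₀ ρ,
        ‖F i x' - F i x - F' i x (x' - x)‖ ≤ η * ‖F i x' - F i x‖)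
    (y : ℕ → Y) (hA3 : xstar ∈ closedBall x₀ (ρ / 2)) (hsol : ∀ i < N, F i xstar = y i)
    (q α τ : ℝ) (hq0 : 0 < q) (hq1 : q < 1)
    (hα : C ^ 2 * q / (1 - q) < α)
    (hτ : (1 + η) / (1 - η) < τ) (hqτ : η + (1 + η) / τ < q)
    (x h : ℕ → X)
    (hx0 : x 0 = x₀)
    (hh : ∀ k, ContinuousLinearMap.adjoint (F' (k % N) (x k)) (F' (k % N) (x k) (h k))
        + α • h k
        = ContinuousLinearMap.adjoint (F' (k % N) (x k)) (y (k % N) - F (k % N) (x k)))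
    (hrec : ∀ k, x (k + 1) = x k + h k)
    (xdag : X) (hxdag_ball : xdag ∈ closedBall x₀ (ρ / 2))
    (hxdag_sol : ∀ i < N, F i xdag = y i)
    (Kdag : Submodule ℝ X)
    (hKdag : ∀ v : X, v ∈ Kdag ↔ ∀ i < N, F' i xdag v = 0)
    (hker : ∀ x' ∈ closedBall x₀ ρ, ∀ i < N, ∀ v ∈ Kdag, F' i x' v = 0)
    :
    (∀ k : ℕ, x k - x₀ ∈ Kdagᗮ) ∧
      ((∀ z ∈ closedBall x₀ (ρ / 2), z - x₀ ∈ Kdagᗮ → (∀ i < N, F i z = y i) → z = xdag) →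
        Tendsto x atTop (nhds xdag)) := by
  have hN0 : 0 < N := hN
  have hτ0 : 0 < τ := lt_of_le_of_lt (div_nonneg (by linarith) (by linarith)) hτ
  have hηq : η < q := by
    have : 0 ≤ (1 + η) / τ := by positivity
    linarith
  have hα0 : 0 < α := lt_of_le_of_lt (div_nonneg (by positivity) (by linarith)) hα
  have hmod : ∀ k, k % N < N := fun k => Nat.mod_lt k hN0
  have hdagρ : xdag ∈ closedBall x₀ ρ := closedBall_subset_closedBall (by linarith) hxdag_ball
  set w : ℕ → Y := fun k => y (k % N) - F (k % N) (x k) with hw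
  have hdecr : ∀ k, x k ∈ closedBall x₀ ρ →
      α * ‖x (k + 1) - xdag‖ ^ 2 + 2 * (q - η) * q * ‖w k‖ ^ 2 ≤ α * ‖x k - xdag‖ ^ 2 := by
    intro k hk
    have h1 := hA2 _ (hmod k) _ hk _ hdagρ
    rw [hxdag_sol _ (hmod k)] at h1
    have h2 : w k + F' (k % N) (x k) (x k - xdag)
        = y (k % N) - F (k % N) (x k) - F' (k % N) (x k) (xdag - x k) := by
      simp only [hw, map_sub]; abel
    have h3 := lm_step_error_decrease hC.le hα0 hq0 hq1 hα (hA1 _ (hmod k) _ hk) hηq.le (hh k)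
      (e := x k - xdag) (by rw [h2]; exact h1)
    rwa [show x k - xdag + h k = x (k + 1) - xdag by rw [hrec]; abel] at h3
  have hc : 0 < 2 * (q - η) * q := by
    have : 0 < q - η := by linarith
    positivity
  have hle_of_mem : ∀ k, x k ∈ closedBall x₀ ρ → ‖x (k + 1) - xdag‖ ≤ ‖x k - xdag‖ := by
    intro k hk
    have h1 : 0 ≤ 2 * (q - η) * q * ‖w k‖ ^ 2 := by positivity
    have h2 := hdecr k hk
    exact le_of_sq_le_sq (le_of_mul_le_mul_left (by linarith) hα0) (norm_nonneg _)
  have hball_aux : ∀ k, ‖x k - xdag‖ ≤ ρ / 2 → x k ∈ closedBall x₀ ρ := by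
    intro k hk
    rw [mem_closedBall] at hxdag_ball ⊢
    rw [← dist_eq_norm] at hk
    linarith [dist_triangle (x k) xdag x₀]
  have herr : ∀ k, ‖x k - xdag‖ ≤ ρ / 2 := by
    intro k
    induction k with
    | zero => rw [hx0, ← dist_eq_norm, dist_comm]; exact hxdag_ball
    | succ k ih => exact (hle_of_mem k (hball_aux k ih)).trans ih
  have hball : ∀ k, x k ∈ closedBall x₀ ρ := fun k => hball_aux k (herr k)
  have hanti : Antitone fun k => ‖x k - xdag‖ :=
    antitone_nat_of_succ_le fun k => hle_of_mem k (hball k)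
  have hperp : ∀ k, x k - x₀ ∈ Kdagᗮ := by
    intro k
    induction k with
    | zero => simp [hx0]
    | succ k ih =>
      rw [hrec, show x k + h k - x₀ = (x k - x₀) + h k by abel]
      refine Kdagᗮ.add_mem ih ((Submodule.mem_orthogonal' _ _).2 fun v hv => ?_)
      have h1 := lm_step_inner (hh k) v
      rw [hker _ (hball k) _ (hmod k) v hv, inner_zero_right] at h1
      exact (mul_eq_zero.1 h1).resolve_left hα0.ne'
  refine ⟨hperp, fun huniq => ?_⟩
  have hwsum : Summable fun k => ‖w k‖ ^ 2 := by
    refine summable_of_sum_range_le (c := α * ‖x 0 - xdag‖ ^ 2 / (2 * (q - η) * q))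
      (fun _ => by positivity) fun n => ?_
    rw [le_div_iff₀ hc]
    have : (∑ k ∈ Finset.range n, ‖w k‖ ^ 2) * (2 * (q - η) * q)
        ≤ α * ‖x 0 - xdag‖ ^ 2 - α * ‖x n - xdag‖ ^ 2 := by
      induction n with
      | zero => simp
      | succ n ih =>
        rw [Finset.sum_range_succ]
        linarith [hdecr n (hball n)]
    have : 0 ≤ α * ‖x n - xdag‖ ^ 2 := by positivity
    linarith
  set R : ℕ → ℝ := fun m => ∑ s ∈ Finset.range N, ‖w (m * N + s)‖ with hR
  have hR0 : ∀ m, 0 ≤ R m := fun m => Finset.sum_nonneg fun _ _ => norm_nonneg _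
  have hwR : ∀ m, ∀ s < N, ‖w (m * N + s)‖ ≤ R m := fun m s hs =>
    Finset.single_le_sum (f := fun s => ‖w (m * N + s)‖) (fun _ _ => norm_nonneg _)
      (Finset.mem_range.2 hs)
  have hRsum : Summable fun m => R m ^ 2 := by
    have h1 : Summable fun m => (N : ℝ) * ∑ s ∈ Finset.range N, ‖w (m * N + s)‖ ^ 2 := by
      refine Summable.mul_left _ (summable_sum fun s _ => ?_)
      refine hwsum.comp_injective (i := fun m => m * N + s) fun a b hab => ?_
      exact Nat.eq_of_mul_eq_mul_right hN0 (Nat.add_right_cancel hab)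
    refine Summable.of_nonneg_of_le (fun _ => by positivity) (fun m => ?_) h1
    simpa using sq_sum_le_card_mul_sum_sq (s := Finset.range N) (f := fun s => ‖w (m * N + s)‖)
  have hhw : ∀ k, ‖h k‖ ≤ C / α * ‖w k‖ := by
    intro k
    have h1 := lm_step_norm_le (hA1 _ (hmod k) _ (hball k)) (hh k)
    have h2 := lm_step_norm_linearized_le hα0.le (hh k)
    rw [div_mul_eq_mul_div, le_div_iff₀ hα0, mul_comm]
    exact h1.trans (by gcongr)
  have hmodadd : ∀ m, ∀ s < N, (m * N + s) % N = s := fun m s hs => by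
    rw [Nat.mul_add_mod_self_right, Nat.mod_eq_of_lt hs]
  have hxdiff : ∀ m, ∀ s ≤ N, ‖x (m * N + s) - x (m * N)‖ ≤ C / α * R m := by
    intro m s hs
    have h1 : ‖x (m * N + s) - x (m * N)‖ ≤ ∑ i ∈ Finset.range s, C / α * ‖w (m * N + i)‖ := by
      clear hs
      induction s with
      | zero => simp
      | succ s ih =>
        rw [Finset.sum_range_succ, ← add_assoc, hrec,
          show x (m * N + s) + h (m * N + s) - x (m * N)
            = (x (m * N + s) - x (m * N)) + h (m * N + s) by abel]
        exact (norm_add_le _ _).trans (add_le_add ih (hhw _))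
    rw [← Finset.mul_sum] at h1
    refine h1.trans ?_
    gcongr
    exact Finset.sum_le_sum_of_subset_of_nonneg (Finset.range_subset_range.2 hs)
      fun _ _ _ => norm_nonneg _
  set D : ℝ := C * (C / α) / (1 - η) + 1 with hD
  have hη1' : 0 < 1 - η := by linarith
  have hD0 : 0 ≤ D := by positivity
  have hres : ∀ m, ∀ s < N, ‖F s (x (m * N)) - y s‖ ≤ D * R m := by
    intro m s hs
    have h1 := hA2 s hs _ (hball (m * N + s)) _ (hball (m * N))
    have h2 := (F' s (x (m * N + s))).le_of_opNorm_le (hA1 s hs _ (hball _))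
      (x (m * N) - x (m * N + s))
    rw [norm_sub_rev (x (m * N))] at h2
    have h3 := norm_sub_norm_le (F s (x (m * N)) - F s (x (m * N + s)))
      (F' s (x (m * N + s)) (x (m * N) - x (m * N + s)))
    have h4 : C * ‖x (m * N + s) - x (m * N)‖ ≤ C * (C / α * R m) := by
      have := hxdiff m s hs.le
      gcongr
    have h5 : ‖F s (x (m * N)) - F s (x (m * N + s))‖ ≤ C * (C / α * R m) / (1 - η) := by
      rw [le_div_iff₀ hη1']; linarith
    have h6 := hwR m s hs
    simp only [hw, hmodadd m s hs] at h6
    rw [norm_sub_rev] at h6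
    calc ‖F s (x (m * N)) - y s‖
        ≤ ‖F s (x (m * N)) - F s (x (m * N + s))‖ + ‖F s (x (m * N + s)) - y s‖ :=
          norm_sub_le_norm_sub_add_norm_sub _ _ _
      _ ≤ C * (C / α * R m) / (1 - η) + R m := add_le_add h5 h6
      _ = D * R m := by rw [hD]; ring
  have hlin : ∀ i < N, ∀ u ∈ closedBall x₀ ρ, ∀ v ∈ closedBall x₀ ρ,
      ‖F' i u (v - u)‖ ≤ (1 + η) * ‖F i v - F i u‖ := by
    intro i hi u hu v hv
    have h1 := hA2 i hi u hu v hv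
    have h2 := norm_sub_norm_le (F' i u (v - u)) (F i v - F i u)
    rw [norm_sub_rev (F' i u (v - u))] at h2
    linarith
  set K₁ : ℝ := (1 + η) * (D + 2) / α with hK₁
  have hK₁0 : 0 ≤ K₁ := by positivity
  have hstep : ∀ m n, ∀ s < N, |inner ℝ (h (m * N + s)) (x (n * N) - xdag)|
      ≤ K₁ * (R m + R n) * ‖w (m * N + s)‖ := by
    intro m n s hs
    have h1 := lm_step_inner (hh (m * N + s)) (x (n * N) - xdag)
    have h2 := lm_step_norm_linearized_le hα0.le (hh (m * N + s))
    have hj := hball (m * N + s)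
    have hwj := hwR m s hs
    simp only [hw] at hwj ⊢
    rw [hmodadd m s hs] at h1 h2 hwj ⊢
    set j := m * N + s
    have h3 := hlin s hs _ hj _ (hball (n * N))
    have h4 := hlin s hs _ hj _ hdagρ
    rw [hxdag_sol s hs] at h4
    have h5 : ‖F s (x (n * N)) - F s (x j)‖ ≤ D * R n + R m := by
      refine (norm_sub_le_norm_sub_add_norm_sub _ (y s) _).trans ?_
      exact add_le_add (hres n s hs) hwj
    have h6 : ‖F' s (x j) (x (n * N) - xdag)‖ ≤ (1 + η) * (D + 2) * (R m + R n) := by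
      rw [show x (n * N) - xdag = (x (n * N) - x j) - (xdag - x j) by abel, map_sub]
      calc _ ≤ _ := norm_sub_le _ _
        _ ≤ (1 + η) * (D * R n + R m) + (1 + η) * R m := by
          refine add_le_add (h3.trans ?_) (h4.trans ?_) <;> gcongr
        _ = (1 + η) * (D * R n + 2 * R m) := by ring
        _ ≤ (1 + η) * ((D + 2) * (R m + R n)) := by
          gcongr
          nlinarith [hR0 m, hR0 n, mul_nonneg hD0 (hR0 m)]
        _ = _ := by ring
    have h7 : α * |inner ℝ (h j) (x (n * N) - xdag)|
        ≤ ‖y s - F s (x j)‖ * ((1 + η) * (D + 2) * (R m + R n)) := by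
      rw [← abs_of_pos hα0, ← abs_mul, h1]
      refine (abs_real_inner_le_norm _ _).trans ?_
      gcongr
    rw [hK₁, div_mul_eq_mul_div, div_mul_eq_mul_div, le_div_iff₀ hα0]
    linarith
  have hcauchy : CauchySeq fun m => x (m * N) := by
    refine cauchySeq_of_antitone_of_inner_le (p := xdag) (R := R) hK₁0 hR0 hRsum
      (fun a b hab => hanti (Nat.mul_le_mul_right N hab)) fun m n => ?_
    have h1 : ∀ s, x (m * N + s) - x (m * N) = ∑ i ∈ Finset.range s, h (m * N + i) := by
      intro s
      induction s with
      | zero => simp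
      | succ s ih => rw [Finset.sum_range_succ, ← ih, ← add_assoc, hrec]; abel
    rw [show (m + 1) * N = m * N + N by ring, h1, sum_inner]
    calc _ ≤ _ := Finset.abs_sum_le_sum_abs _ _
      _ ≤ ∑ s ∈ Finset.range N, K₁ * (R m + R n) * ‖w (m * N + s)‖ :=
        Finset.sum_le_sum fun s hs => hstep m n s (Finset.mem_range.1 hs)
      _ = K₁ * (R m + R n) * R m := by rw [← Finset.mul_sum]
      _ = _ := by ring
  obtain ⟨L, hL⟩ := cauchySeq_tendsto_of_complete hcauchy
  have hLball : L ∈ closedBall x₀ ρ :=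
    isClosed_closedBall.mem_of_tendsto hL (Eventually.of_forall fun m => hball _)
  have hLperp : L - x₀ ∈ Kdagᗮ :=
    Kdag.isClosed_orthogonal.mem_of_tendsto (hL.sub_const x₀)
      (Eventually.of_forall fun m => hperp _)
  have hRlim : Tendsto R atTop (nhds 0) := by
    have h1 := (hRsum.tendsto_atTop_zero).sqrt
    simpa [Real.sqrt_sq (hR0 _)] using h1
  have hLsol : ∀ i < N, F i L = y i := by
    intro i hi
    refine tendsto_nhds_unique (((hFcont i hi).tendsto L).comp hL) ?_
    rw [tendsto_iff_norm_sub_tendsto_zero]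
    exact squeeze_zero (fun _ => norm_nonneg _) (fun m => hres m i hi)
      (by simpa using hRlim.const_mul D)
  have hLdag : L - xdag ∈ Kdag := by
    rw [hKdag]
    intro i hi
    have h1 := hlin i hi _ hdagρ _ hLball
    rw [hLsol i hi, hxdag_sol i hi, sub_self, norm_zero, mul_zero] at h1
    exact norm_le_zero_iff.1 h1
  have hLeq : L = xdag := by
    refine huniq L ?_ hLperp hLsol
    rw [mem_closedBall, dist_eq_norm] at hxdag_ball ⊢
    refine le_trans ?_ hxdag_ball
    have h1 : inner ℝ (L - x₀) (L - xdag) = 0 :=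
      (Submodule.mem_orthogonal' _ _).1 hLperp _ hLdag
    have h2 : ‖xdag - x₀‖ ^ 2 = ‖L - x₀‖ ^ 2 + ‖L - xdag‖ ^ 2 := by
      rw [show xdag - x₀ = (L - x₀) - (L - xdag) by abel, norm_sub_sq_real, h1]; ring
    exact le_of_sq_le_sq (by linarith [sq_nonneg ‖L - xdag‖]) (norm_nonneg _)
  subst hLeq
  rw [Metric.tendsto_atTop] at hL ⊢
  intro ε hε
  obtain ⟨m, hm⟩ := hL ε hε
  refine ⟨m * N, fun k hk => ?_⟩
  have h1 := hm m le_rfl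
  rw [dist_eq_norm] at h1 ⊢
  exact (hanti hk).trans_lt h1
end

section
/- (Regularization property / convergence for noisy data) Let δ_j = (δ_{j,0}, …, δ_{j,N−1}) ∈ (0,∞)^N be a sequence of noise-level vectors with δ_j → 0, and let y^{δ_j} ∈ Y^N be corresponding noisy data with ‖y_i^{δ_j} − y_i‖ ≤ δ_{j,i} for all i and j. Denote by x_k^{δ_j} the l-LMK iterates computed with data y^{δ_j} and by k*^j the corresponding stopping index. Then the sequence of final iterates x_{k*^j}^{δ_j} converges, as j → ∞, to a solution x⁺ of the system, i.e., F_i(x⁺) = y_i for all i ∈ {0,…,N−1}. -/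
open Metric Filter

open scoped InnerProductSpace in
/-- A sequence whose distance to `x` is nonincreasing is Cauchy as soon as its increments are
almost orthogonal to the errors `z m - x` with small `R m`. -/
lemma cauchySeq_of_abs_inner_le {X : Type*} [NormedAddCommGroup X] [InnerProductSpace ℝ X]
    {z : ℕ → X} {x : X} {R : ℕ → ℝ} {c : ℝ}
    (hanti : Antitone fun p => ‖z p - x‖ ^ 2)
    (h : ∀ p m, R m ≤ R p →
      |⟪z (p + 1) - z p, z m - x⟫_ℝ| ≤ c * (‖z p - x‖ ^ 2 - ‖z (p + 1) - x‖ ^ 2)) :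
    CauchySeq z := by
  set E : ℕ → ℝ := fun p => ‖z p - x‖ ^ 2 with hE
  have hc : ∀ p, 0 ≤ c * (E p - E (p + 1)) := fun p => (abs_nonneg _).trans (h p p le_rfl)
  have hsum : ∀ m a b, a ≤ b → (∀ p, a ≤ p → p < b → R m ≤ R p) →
      |⟪z b - z a, z m - x⟫_ℝ| ≤ c * (E a - E b) := by
    intro m a b hab
    induction b, hab using Nat.le_induction with
    | base => intro _; simp
    | succ b hab ih =>
      intro hR
      have h1 := ih fun p hp hpb => hR p hp (by lia)
      have h2 := h b m (hR b hab (by lia))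
      have h3 : z (b + 1) - z a = (z (b + 1) - z b) + (z b - z a) := by abel
      rw [h3, inner_add_left]
      refine (abs_add_le _ _).trans ?_
      simp only [hE] at *
      linarith
  have hsq : ∀ a m : ℕ, ‖z a - z m‖ ^ 2 = E a - E m + 2 * ⟪z m - z a, z m - x⟫_ℝ := by
    intro a m
    have h1 : z a - x = (z m - x) - (z m - z a) := by abel
    have h2 : ‖z a - z m‖ = ‖z m - z a‖ := norm_sub_rev _ _
    simp only [hE]
    rw [h2, h1, norm_sub_sq_real (z m - x) (z m - z a), real_inner_comm]
    ring
  obtain ⟨e, he⟩ : ∃ e, Tendsto E atTop (nhds e) :=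
    ⟨_, tendsto_atTop_ciInf hanti ⟨0, by rintro _ ⟨p, rfl⟩; positivity⟩⟩
  have hEe : ∀ p, e ≤ E p := fun p => hanti.le_of_tendsto he p
  have hclose : ∀ a b, a ≤ b → dist (z a) (z b) ≤ 2 * √((1 + 2 * |c|) * (E a - e)) := by
    intro a b hab
    obtain ⟨m, hm, hmin⟩ := Finset.exists_min_image (Finset.Icc a b) R ⟨a, by simp [hab]⟩
    rw [Finset.mem_Icc] at hm
    have h1 := hsum m a m hm.1 fun p hp hpm => hmin p (by rw [Finset.mem_Icc]; lia)
    have h2 := hsum m m b hm.2 fun p hp hpm => hmin p (by rw [Finset.mem_Icc]; lia)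
    have ham : E m ≤ E a := hanti hm.1
    have hmb : E b ≤ E m := hanti hm.2
    have heb := hEe b
    have hcabs := le_abs_self c
    have hcn := abs_nonneg c
    have h3 : ‖z a - z m‖ ^ 2 ≤ (1 + 2 * |c|) * (E a - e) := by
      rw [hsq]
      have := (abs_le.1 h1).2
      nlinarith
    have h4 : ‖z b - z m‖ ^ 2 ≤ (1 + 2 * |c|) * (E a - e) := by
      rw [hsq, ← neg_sub (z b), inner_neg_left]
      have := (abs_le.1 h2).1
      nlinarith
    have h5 := Real.le_sqrt_of_sq_le h3
    have h6 := Real.le_sqrt_of_sq_le h4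
    have h7 := dist_triangle_right (z a) (z b) (z m)
    rw [dist_eq_norm (z a) (z m), dist_eq_norm (z b) (z m)] at h7
    linarith
  refine cauchySeq_of_le_tendsto_0' _ hclose ?_
  have h0 : Tendsto (fun a => (1 + 2 * |c|) * (E a - e)) atTop (nhds 0) := by
    simpa using (he.sub_const e).const_mul (1 + 2 * |c|)
  simpa using ((Real.continuous_sqrt.tendsto 0).comp (by simpa using h0)).const_mul 2

section RegularizedNormalEquation

variable {X Y : Type*} [NormedAddCommGroup X] [InnerProductSpace ℝ X] [CompleteSpace X]
    [NormedAddCommGroup Y] [InnerProductSpace ℝ Y] [CompleteSpace Y]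

open scoped InnerProductSpace

open ContinuousLinearMap (adjoint)

lemma mul_norm_le_norm_adjoint_apply_add_smul (A : X →L[ℝ] Y) {α : ℝ} (h : X) :
    α * ‖h‖ ≤ ‖adjoint A (A h) + α • h‖ := by
  rcases eq_or_ne h 0 with rfl | hne
  · simp
  have hpos : 0 < ‖h‖ := norm_pos_iff.2 hne
  have h1 : ⟪adjoint A (A h) + α • h, h⟫_ℝ = ‖A h‖ ^ 2 + α * ‖h‖ ^ 2 := by
    rw [inner_add_left, ContinuousLinearMap.adjoint_inner_left, real_inner_self_eq_norm_sq,
      real_inner_smul_left, real_inner_self_eq_norm_sq]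
  have h2 := real_inner_le_norm (adjoint A (A h) + α • h) h
  have h3 := sq_nonneg ‖A h‖
  refine le_of_mul_le_mul_right ?_ hpos
  nlinarith

lemma exists_adjoint_apply_add_smul_eq (A : X →L[ℝ] Y) {α : ℝ} (hα : 0 < α) (v : X) :
    ∃ h, adjoint A (A h) + α • h = v := by
  let G : X →L[ℝ] X := adjoint A ∘L A + α • ContinuousLinearMap.id ℝ X
  have hG : IsUnit G := by
    refine ContinuousLinearMap.isUnit_of_forall_le_norm_inner_map G
      (c := α.toNNReal) (Real.toNNReal_pos.2 hα) fun x => ?_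
    have h1 : ⟪G x, x⟫_ℝ = ‖A x‖ ^ 2 + α * ‖x‖ ^ 2 := by
      simp only [G, add_apply, ContinuousLinearMap.comp_apply,
        smul_apply, ContinuousLinearMap.id_apply]
      rw [inner_add_left, ContinuousLinearMap.adjoint_inner_left, real_inner_self_eq_norm_sq,
        real_inner_smul_left, real_inner_self_eq_norm_sq]
    rw [h1, Real.norm_of_nonneg (by positivity), Real.coe_toNNReal _ hα.le]
    nlinarith [sq_nonneg ‖A x‖]
  obtain ⟨u, hu⟩ := hG
  refine ⟨(↑u⁻¹ : X →L[ℝ] X) v, ?_⟩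
  have h2 : G ((↑u⁻¹ : X →L[ℝ] X) v) = v := by
    rw [← hu, ← mul_apply_eq_comp, Units.mul_inv, one_apply_eq_self]
  simpa [G] using h2

lemma tendsto_of_adjoint_apply_add_smul_eq {ι : Type*} {f : Filter ι} {A : ι → X →L[ℝ] Y}
    {A₀ : X →L[ℝ] Y} {r : ι → Y} {r₀ : Y} {h : ι → X} {h₀ : X} {α : ℝ} (hα : 0 < α)
    (hA : Tendsto A f (nhds A₀)) (hr : Tendsto r f (nhds r₀))
    (hh : ∀ j, adjoint (A j) (A j (h j)) + α • h j = adjoint (A j) (r j))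
    (hh₀ : adjoint A₀ (A₀ h₀) + α • h₀ = adjoint A₀ r₀) :
    Tendsto h f (nhds h₀) := by
  have hadj : Tendsto (fun j => adjoint (A j)) f (nhds (adjoint A₀)) :=
    (adjoint (𝕜 := ℝ) (E := X) (F := Y)).continuous.tendsto A₀ |>.comp hA
  have hv : Tendsto (fun j => ‖adjoint (A j) (r j) - (adjoint (A j) (A j h₀) + α • h₀)‖ / α) f
      (nhds 0) := by
    have happ₁ := (isBoundedBilinearMap_apply (𝕜 := ℝ) (E := X) (F := Y)).continuous
    have happ₂ := (isBoundedBilinearMap_apply (𝕜 := ℝ) (E := Y) (F := X)).continuous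
    have h1 := (happ₂.tendsto (_, _)).comp (hadj.prodMk_nhds hr)
    have h2 := (happ₂.tendsto (_, _)).comp (hadj.prodMk_nhds
      ((happ₁.tendsto (_, _)).comp (hA.prodMk_nhds (tendsto_const_nhds (x := h₀)))))
    have h3 := (h1.sub (h2.add_const (α • h₀))).norm.div_const α
    simpa only [hh₀, sub_self, norm_zero, zero_div, Function.comp_def] using h3
  rw [tendsto_iff_norm_sub_tendsto_zero]
  refine squeeze_zero (fun j => norm_nonneg _) (fun j => ?_) hv
  rw [le_div_iff₀ hα, mul_comm]
  refine (mul_norm_le_norm_adjoint_apply_add_smul (A j) _).trans_eq ?_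
  rw [← hh j, map_sub, map_sub, smul_sub]
  congr 1
  abel

variable {A : X →L[ℝ] Y} {h : X} {r : Y} {α : ℝ}

lemma smul_eq_neg_adjoint_apply_sub (hh : adjoint A (A h) + α • h = adjoint A r) :
    α • h = - adjoint A (A h - r) := by
  rw [map_sub, ← hh]
  abel

lemma norm_apply_sub_le (hα : 0 < α) (hh : adjoint A (A h) + α • h = adjoint A r) :
    ‖A h - r‖ ≤ ‖r‖ := by
  have h1 : ⟪A h, A h - r⟫_ℝ = - (α * ‖h‖ ^ 2) := by
    rw [← ContinuousLinearMap.adjoint_inner_right, ← neg_neg (adjoint A (A h - r)),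
      ← smul_eq_neg_adjoint_apply_sub hh, inner_neg_right, real_inner_smul_right,
      real_inner_self_eq_norm_sq]
  have h2 : ‖r‖ ^ 2 = ‖A h‖ ^ 2 - 2 * ⟪A h, A h - r⟫_ℝ + ‖A h - r‖ ^ 2 := by
    rw [← norm_sub_sq_real]
    congr 2
    abel
  refine le_of_sq_le_sq ?_ (norm_nonneg _)
  nlinarith [sq_nonneg ‖A h‖, mul_nonneg hα.le (sq_nonneg ‖h‖)]

lemma abs_inner_le_of_adjoint_apply_add_smul_eq (hα : 0 < α)
    (hh : adjoint A (A h) + α • h = adjoint A r) (w : X) :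
    |⟪h, w⟫_ℝ| ≤ α⁻¹ * (‖r‖ * ‖A w‖) := by
  have h1 : α * ⟪h, w⟫_ℝ = - ⟪A h - r, A w⟫_ℝ := by
    rw [← real_inner_smul_left, smul_eq_neg_adjoint_apply_sub hh, inner_neg_left,
      ContinuousLinearMap.adjoint_inner_left]
  have h2 : α * |⟪h, w⟫_ℝ| ≤ ‖r‖ * ‖A w‖ := by
    rw [← abs_of_pos hα, ← abs_mul, h1, abs_neg]
    exact (abs_real_inner_le_norm _ _).trans
      (mul_le_mul_of_nonneg_right (norm_apply_sub_le hα hh) (norm_nonneg _))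
  rw [inv_mul_eq_div, le_div_iff₀ hα]
  linarith

lemma norm_le_of_adjoint_apply_add_smul_eq (hα : 0 < α)
    (hh : adjoint A (A h) + α • h = adjoint A r) {C : ℝ} (hC : ‖A‖ ≤ C) :
    ‖h‖ ≤ C / α * ‖r‖ := by
  have h1 := mul_norm_le_norm_adjoint_apply_add_smul A (α := α) h
  rw [hh] at h1
  have h2 : ‖adjoint A r‖ ≤ C * ‖r‖ := by
    refine ((adjoint A).le_opNorm r).trans ?_
    rw [LinearIsometryEquiv.norm_map]
    gcongr
  rw [div_mul_eq_mul_div, le_div_iff₀ hα]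
  linarith

/-- One Levenberg–Marquardt step decreases the squared error by a multiple of the squared
residual. -/
lemma norm_add_sq_le_of_adjoint_apply_add_smul_eq {C q θ : ℝ} {e : X} (hα : 0 < α)
    (hh : adjoint A (A h) + α • h = adjoint A r) (hC : ‖A‖ ≤ C) (hq0 : 0 < q) (hq1 : q < 1)
    (hCq : C ^ 2 * q / (1 - q) < α) (hθ : θ ≤ q) (hlin : ‖r + A e‖ ≤ θ * ‖r‖) :
    ‖e + h‖ ^ 2 ≤ ‖e‖ ^ 2 - 2 / α * (q * (q - θ)) * ‖r‖ ^ 2 := by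
  set B := A h - r with hB
  have hCn : 0 ≤ C := (norm_nonneg A).trans hC
  have hαh : α • h = - adjoint A B := smul_eq_neg_adjoint_apply_sub hh
  have hadj : α * ‖h‖ ≤ C * ‖B‖ := by
    have h1 : ‖α • h‖ = α * ‖h‖ := by rw [norm_smul, Real.norm_of_nonneg hα.le]
    rw [← h1, hαh, norm_neg]
    refine ((adjoint A).le_opNorm B).trans ?_
    rw [LinearIsometryEquiv.norm_map]
    gcongr
  have hBr : q * ‖r‖ ≤ ‖B‖ := by
    have h1 : ‖r‖ ≤ ‖A h‖ + ‖B‖ := by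
      have : r = A h - B := by rw [hB]; abel
      calc ‖r‖ = ‖A h - B‖ := by rw [← this]
        _ ≤ _ := norm_sub_le _ _
    have h2 : ‖A h‖ ≤ C * ‖h‖ := A.le_of_opNorm_le hC h
    have h3 : C ^ 2 * q < α * (1 - q) := (div_lt_iff₀ (by linarith)).1 hCq
    have h4 : α * ‖r‖ ≤ (C ^ 2 + α) * ‖B‖ := by nlinarith
    have h5 : q * (α * ‖r‖) ≤ α * ‖B‖ := by nlinarith [norm_nonneg B]
    refine le_of_mul_le_mul_left ?_ hα
    linarith
  have hinner : ⟪e + h, α • h⟫_ℝ = - ‖B‖ ^ 2 - ⟪r + A e, B⟫_ℝ := by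
    have h1 : A (e + h) = B + (r + A e) := by rw [hB, map_add]; abel
    rw [hαh, inner_neg_right, ContinuousLinearMap.adjoint_inner_right, h1, inner_add_left,
      real_inner_self_eq_norm_sq]
    ring
  have hbound : ⟪e + h, α • h⟫_ℝ ≤ - (q * (q - θ) * ‖r‖ ^ 2) := by
    have h1 := (abs_le.1 (abs_real_inner_le_norm (r + A e) B)).1
    have h2 : ‖r + A e‖ * ‖B‖ ≤ θ * ‖r‖ * ‖B‖ := by gcongr
    have h3 : q * ‖r‖ * ((q - θ) * ‖r‖) ≤ ‖B‖ * (‖B‖ - θ * ‖r‖) := by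
      refine mul_le_mul hBr (by linarith) ?_ (norm_nonneg _)
      exact mul_nonneg (by linarith) (norm_nonneg _)
    nlinarith
  have hexp : ‖e + h‖ ^ 2 = ‖e‖ ^ 2 + 2 * ⟪e + h, h⟫_ℝ - ‖h‖ ^ 2 := by
    rw [norm_add_sq_real, inner_add_left, real_inner_self_eq_norm_sq]
    ring
  rw [real_inner_smul_right] at hbound
  have h6 : ⟪e + h, h⟫_ℝ ≤ - (q * (q - θ) * ‖r‖ ^ 2) / α := by
    rw [le_div_iff₀ hα]
    linarith
  rw [hexp]
  have h7 : 2 / α * (q * (q - θ)) * ‖r‖ ^ 2 = - (2 * (- (q * (q - θ) * ‖r‖ ^ 2) / α)) := by ring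
  rw [h7]
  nlinarith [sq_nonneg ‖h‖]

end RegularizedNormalEquation

lemma norm_le_of_tangentialCone {Y : Type*} [NormedAddCommGroup Y] {η : ℝ} {u v : Y} (h : ‖u - v‖ ≤ η * ‖u‖) :
    ‖v‖ ≤ (1 + η) * ‖u‖ := by
  have := norm_sub_norm_le v u
  rw [norm_sub_rev] at this
  linarith

lemma norm_le_div_of_tangentialCone {Y : Type*} [NormedAddCommGroup Y] {η : ℝ} (hη1 : η < 1) {u v : Y}
    (h : ‖u - v‖ ≤ η * ‖u‖) : ‖u‖ ≤ ‖v‖ / (1 - η) := by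
  have := norm_sub_norm_le u v
  rw [le_div_iff₀ (by linarith)]
  linarith

lemma norm_residual_add_apply_le {X Y : Type*} [NormedAddCommGroup X] [NormedSpace ℝ X]
    [NormedAddCommGroup Y] [NormedSpace ℝ Y] {η : ℝ} (hη0 : 0 ≤ η) {f f' : Y} {L : X →L[ℝ] Y} {x x' : X}
    (h : ‖f' - f - L (x' - x)‖ ≤ η * ‖f' - f‖) (y : Y) :
    ‖(y - f) + L (x - x')‖ ≤ η * ‖y - f‖ + (1 + η) * ‖y - f'‖ := by
  have h1 : (y - f) + L (x - x') = (y - f') + (f' - f - L (x' - x)) := by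
    rw [← neg_sub x' x, map_neg]; abel
  have h2 : ‖f' - f‖ ≤ ‖y - f‖ + ‖y - f'‖ := by
    have : f' - f = (y - f) - (y - f') := by abel
    rw [this]
    exact norm_sub_le _ _
  rw [h1]
  have h3 := norm_add_le (y - f') (f' - f - L (x' - x))
  have h4 := mul_le_mul_of_nonneg_left h2 hη0
  linarith

section Iteration

variable {X Y : Type*} [NormedAddCommGroup X] [InnerProductSpace ℝ X] [CompleteSpace X]
    [NormedAddCommGroup Y] [InnerProductSpace ℝ Y] [CompleteSpace Y]

open ContinuousLinearMap (adjoint)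

open scoped InnerProductSpace

/-- The Levenberg–Marquardt–Kaczmarz iteration with exact data converges along full cycles. -/
lemma exists_tendsto_cycle_of_exact_data
    {N : ℕ} (hN : 1 ≤ N) {F : ℕ → X → Y} {F' : ℕ → X → (X →L[ℝ] Y)}
    (hFcont : ∀ i < N, Continuous (F i))
    {x₀ xstar : X} {ρ C η : ℝ} (hη0 : 0 ≤ η) (hη1 : η < 1)
    (hA1 : ∀ i < N, ∀ x ∈ closedBall x₀ ρ, ‖F' i x‖ ≤ C)
    (hA2 : ∀ i < N, ∀ x ∈ closedBall x₀ ρ, ∀ x' ∈ closedBall x₀ ρ,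
        ‖F i x' - F i x - F' i x (x' - x)‖ ≤ η * ‖F i x' - F i x‖)
    {y : ℕ → Y} (hA3 : xstar ∈ closedBall x₀ (ρ / 2)) (hsol : ∀ i < N, F i xstar = y i)
    {q α : ℝ} (hq0 : 0 < q) (hq1 : q < 1) (hηq : η < q)
    (hα : C ^ 2 * q / (1 - q) < α)
    {x h : ℕ → X} (hx0 : x 0 = x₀)
    (hh : ∀ k, adjoint (F' (k % N) (x k)) (F' (k % N) (x k) (h k)) + α • h k
        = adjoint (F' (k % N) (x k)) (y (k % N) - F (k % N) (x k)))
    (hx : ∀ k, x (k + 1) = x k + h k) :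
    ∃ xp ∈ closedBall x₀ ρ, Tendsto (fun m => x (m * N)) atTop (nhds xp) ∧
      ∀ i < N, F i xp = y i := by
  have hα0 : 0 < α := lt_of_le_of_lt (div_nonneg (by positivity) (by linarith)) hα
  have hmod : ∀ k, k % N < N := fun k => Nat.mod_lt _ hN
  have hd : dist xstar x₀ ≤ ρ / 2 := hA3
  have hρ : 0 ≤ ρ := by linarith [dist_nonneg (x := xstar) (y := x₀)]
  have hball : ∀ u : X, ‖u - xstar‖ ≤ ρ / 2 → u ∈ closedBall x₀ ρ := by
    intro u hu
    rw [mem_closedBall]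
    rw [← dist_eq_norm] at hu
    linarith [dist_triangle u xstar x₀]
  have hstar : xstar ∈ closedBall x₀ ρ := hball _ (by simp; linarith)
  set γ : ℝ := 2 / α * (q * (q - η)) with hγ
  have hγ0 : 0 < γ := mul_pos (by positivity) (mul_pos hq0 (by linarith))
  set r : ℕ → Y := fun k => y (k % N) - F (k % N) (x k) with hr
  have hstep : ∀ k, x k ∈ closedBall x₀ ρ →
      ‖x (k + 1) - xstar‖ ^ 2 ≤ ‖x k - xstar‖ ^ 2 - γ * ‖r k‖ ^ 2 := by
    intro k hk
    have h1 := norm_residual_add_apply_le hη0 (hA2 _ (hmod k) _ hk _ hstar) (y (k % N))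
    rw [hsol _ (hmod k), sub_self, norm_zero, mul_zero, add_zero] at h1
    have h2 := norm_add_sq_le_of_adjoint_apply_add_smul_eq hα0 (hh k) (hA1 _ (hmod k) _ hk)
      hq0 hq1 hα hηq.le h1
    rwa [hx, add_sub_right_comm]
  have hhalf : ∀ k, ‖x k - xstar‖ ≤ ρ / 2 := by
    intro k
    induction k with
    | zero => rwa [hx0, ← dist_eq_norm, dist_comm]
    | succ k ih =>
      refine le_trans (le_of_sq_le_sq ?_ (norm_nonneg _)) ih
      have := hstep k (hball _ ih)
      have : 0 ≤ γ * ‖r k‖ ^ 2 := by positivity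
      linarith
  have hxball : ∀ k, x k ∈ closedBall x₀ ρ := fun k => hball _ (hhalf k)
  set E : ℕ → ℝ := fun k => ‖x k - xstar‖ ^ 2 with hE
  have hEstep : ∀ k, γ * ‖r k‖ ^ 2 ≤ E k - E (k + 1) := fun k => by
    have := hstep k (hxball k)
    simp only [hE]
    linarith
  have hEanti : Antitone E := antitone_nat_of_succ_le fun k => by
    have := hEstep k
    have : 0 ≤ γ * ‖r k‖ ^ 2 := by positivity
    linarith
  set R : ℕ → ℝ := fun p => ∑ i ∈ Finset.range N, ‖r (p * N + i)‖ with hR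
  have hR0 : ∀ p, 0 ≤ R p := fun p => Finset.sum_nonneg fun _ _ => norm_nonneg _
  have hrR : ∀ p, ∀ i < N, ‖r (p * N + i)‖ ≤ R p := fun p i hi =>
    Finset.single_le_sum (f := fun i => ‖r (p * N + i)‖) (fun _ _ => norm_nonneg _)
      (Finset.mem_range.2 hi)
  have hRE : ∀ p, R p ^ 2 ≤ N / γ * (E (p * N) - E ((p + 1) * N)) := by
    intro p
    have h1 : R p ^ 2 ≤ N * ∑ i ∈ Finset.range N, ‖r (p * N + i)‖ ^ 2 := by
      simpa using sq_sum_le_card_mul_sum_sq (s := Finset.range N) (f := fun i => ‖r (p * N + i)‖)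
    have h2 : γ * ∑ i ∈ Finset.range N, ‖r (p * N + i)‖ ^ 2 ≤ E (p * N) - E ((p + 1) * N) := by
      have h3 := Finset.sum_range_sub' (fun i => E (p * N + i)) N
      rw [add_zero, show p * N + N = (p + 1) * N by ring] at h3
      rw [Finset.mul_sum, ← h3]
      exact Finset.sum_le_sum fun i _ => hEstep (p * N + i)
    calc R p ^ 2 ≤ N / γ * (γ * ∑ i ∈ Finset.range N, ‖r (p * N + i)‖ ^ 2) := by
          rwa [← mul_assoc, div_mul_cancel₀ _ hγ0.ne']
      _ ≤ _ := by gcongr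
  have hidx : ∀ p, ∀ i < N, (p * N + i) % N = i := fun p i hi => by
    rw [Nat.mul_add_mod_self_right, Nat.mod_eq_of_lt hi]
  have hC0 : 0 ≤ C := (norm_nonneg _).trans (hA1 0 hN xstar hstar)
  have hdrift : ∀ p, ∀ i ≤ N, ‖x (p * N + i) - x (p * N)‖ ≤ C / α * R p := by
    intro p i hi
    have h1 : x (p * N + i) - x (p * N) = ∑ s ∈ Finset.range i, h (p * N + s) := by
      have h2 := Finset.sum_range_sub (fun i => x (p * N + i)) i
      rw [add_zero] at h2
      rw [← h2]
      exact Finset.sum_congr rfl fun s _ => by rw [← add_assoc, hx, add_sub_cancel_left]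
    rw [h1, hR, Finset.mul_sum]
    refine (norm_sum_le _ _).trans ?_
    refine (Finset.sum_le_sum fun s _ => norm_le_of_adjoint_apply_add_smul_eq hα0 (hh (p * N + s))
      (hA1 _ (hmod _) _ (hxball _))).trans ?_
    exact Finset.sum_le_sum_of_subset_of_nonneg (by simpa using hi) fun _ _ _ => by positivity
  set c₀ : ℝ := 1 + C * (C / α) / (1 - η) with hc₀
  have hη1' : 0 < 1 - η := by linarith
  have hc₀0 : 0 ≤ c₀ := by positivity
  have hcycle : ∀ p, ∀ i < N, ‖y i - F i (x (p * N))‖ ≤ c₀ * R p := by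
    intro p i hi
    have h1 := hrR p i hi
    simp only [hr, hidx p i hi] at h1
    have h2 := norm_le_div_of_tangentialCone hη1
      (hA2 i hi _ (hxball (p * N)) _ (hxball (p * N + i)))
    have h3 : ‖F' i (x (p * N)) (x (p * N + i) - x (p * N))‖ ≤ C * (C / α * R p) :=
      ((F' i (x (p * N))).le_of_opNorm_le (hA1 i hi _ (hxball _)) _).trans
        (mul_le_mul_of_nonneg_left (hdrift p i hi.le) hC0)
    have h4 : ‖F i (x (p * N + i)) - F i (x (p * N))‖ ≤ C * (C / α * R p) / (1 - η) :=
      h2.trans (by gcongr)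
    have h5 : c₀ * R p = R p + C * (C / α * R p) / (1 - η) := by rw [hc₀]; ring
    rw [h5]
    exact (norm_sub_le_norm_sub_add_norm_sub _ (F i (x (p * N + i))) _).trans (add_le_add h1 h4)
  have hlin : ∀ p m, R m ≤ R p → ∀ i < N,
      ‖F' ((p * N + i) % N) (x (p * N + i)) (x (m * N) - xstar)‖
        ≤ (1 + η) * (c₀ + 2) * R p := by
    intro p m hmp i hi
    set L := F' ((p * N + i) % N) (x (p * N + i)) with hL
    rw [hidx p i hi] at hL
    have h1 := hrR p i hi
    simp only [hr, hidx p i hi] at h1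
    have h2 := norm_le_of_tangentialCone
      (hA2 i hi _ (hxball (p * N + i)) _ (hxball (m * N)))
    have h3 := norm_le_of_tangentialCone (hA2 i hi _ (hxball (p * N + i)) _ hstar)
    rw [← hL] at h2 h3
    rw [hsol i hi] at h3
    have h4 : ‖F i (x (m * N)) - F i (x (p * N + i))‖ ≤ c₀ * R p + R p := by
      refine (norm_sub_le_norm_sub_add_norm_sub _ (y i) _).trans (add_le_add ?_ h1)
      rw [norm_sub_rev]
      exact (hcycle m i hi).trans (by gcongr)
    have h5 : L (x (m * N) - xstar)
        = L (x (m * N) - x (p * N + i)) - L (xstar - x (p * N + i)) := by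
      rw [← map_sub]; congr 1; abel
    have h6 : (1 + η) * ‖F i (x (m * N)) - F i (x (p * N + i))‖ ≤ (1 + η) * (c₀ * R p + R p) := by
      gcongr
    have h7 : (1 + η) * ‖y i - F i (x (p * N + i))‖ ≤ (1 + η) * R p := by gcongr
    rw [h5]
    refine (norm_sub_le _ _).trans ?_
    linarith
  set c₁ : ℝ := α⁻¹ * ((1 + η) * (c₀ + 2)) with hc₁
  have hc₁0 : 0 ≤ c₁ := by positivity
  have hinner : ∀ p m, R m ≤ R p →
      |⟪x ((p + 1) * N) - x (p * N), x (m * N) - xstar⟫_ℝ|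
        ≤ c₁ * (N / γ) * (E (p * N) - E ((p + 1) * N)) := by
    intro p m hmp
    have h1 : x ((p + 1) * N) - x (p * N) = ∑ s ∈ Finset.range N, h (p * N + s) := by
      have h2 := Finset.sum_range_sub (fun i => x (p * N + i)) N
      rw [add_zero, show p * N + N = (p + 1) * N by ring] at h2
      rw [← h2]
      exact Finset.sum_congr rfl fun s _ => by rw [← add_assoc, hx, add_sub_cancel_left]
    have h3 : c₁ * R p ^ 2
        = ∑ i ∈ Finset.range N, α⁻¹ * (‖r (p * N + i)‖ * ((1 + η) * (c₀ + 2) * R p)) := by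
      rw [← Finset.mul_sum, ← Finset.sum_mul, hc₁]
      change _ = α⁻¹ * (R p * _)
      ring
    have h4 : |⟪x ((p + 1) * N) - x (p * N), x (m * N) - xstar⟫_ℝ| ≤ c₁ * R p ^ 2 := by
      rw [h1, sum_inner, h3]
      refine (Finset.abs_sum_le_sum_abs _ _).trans (Finset.sum_le_sum fun i hi => ?_)
      refine (abs_inner_le_of_adjoint_apply_add_smul_eq hα0 (hh (p * N + i)) _).trans ?_
      have h5 := hlin p m hmp i (Finset.mem_range.1 hi)
      gcongr
    rw [mul_assoc]
    exact h4.trans (mul_le_mul_of_nonneg_left (hRE p) hc₁0)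
  have hEN : Antitone fun p => E (p * N) := fun a b hab => hEanti (Nat.mul_le_mul_right N hab)
  obtain ⟨xp, hxp⟩ := cauchySeq_tendsto_of_complete (cauchySeq_of_abs_inner_le
    (z := fun p => x (p * N)) (x := xstar) hEN hinner)
  obtain ⟨e, he⟩ : ∃ e, Tendsto (fun p => E (p * N)) atTop (nhds e) :=
    ⟨_, tendsto_atTop_ciInf hEN ⟨0, by rintro _ ⟨p, rfl⟩; positivity⟩⟩
  have hRlim : Tendsto R atTop (nhds 0) := by
    have h1 : Tendsto (fun p => N / γ * (E (p * N) - E ((p + 1) * N))) atTop (nhds 0) := by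
      simpa using (he.sub (he.comp (tendsto_add_atTop_nat 1))).const_mul (N / γ)
    have h2 : Tendsto (fun p => R p ^ 2) atTop (nhds 0) :=
      squeeze_zero (fun _ => sq_nonneg _) hRE h1
    have h3 := (Real.continuous_sqrt.tendsto 0).comp h2
    rw [Real.sqrt_zero] at h3
    exact h3.congr fun p => Real.sqrt_sq (hR0 p)
  refine ⟨xp, isClosed_closedBall.mem_of_tendsto hxp (Eventually.of_forall fun _ => hxball _),
    hxp, fun i hi => ?_⟩
  have h1 : Tendsto (fun p => ‖y i - F i (x (p * N))‖) atTop (nhds 0) :=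
    squeeze_zero (fun _ => norm_nonneg _) (fun p => hcycle p i hi)
      (by simpa using hRlim.const_mul c₀)
  have h2 : Tendsto (fun p => ‖y i - F i (x (p * N))‖) atTop (nhds ‖y i - F i xp‖) :=
    ((((hFcont i hi).tendsto xp).comp hxp).const_sub (y i)).norm
  have h3 := tendsto_nhds_unique h2 h1
  exact (sub_eq_zero.1 (norm_eq_zero.1 h3)).symm

end Iteration

/-- Regularization property / convergence for noisy data: if `δ_j → 0`,
`x_k^{δ_j}` are the l-LMK iterates for the noisy data `y^{δ_j}`, and `k*^j = l_j·N` are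
the corresponding (finite) stopping indices, then the final iterates `x_{k*^j}^{δ_j}`
converge, as `j → ∞`, to a solution `x⁺` of the system `F_i(x⁺) = y_i`, `i < N`. -/
theorem stmt_17
    {X Y : Type*} [NormedAddCommGroup X] [InnerProductSpace ℝ X] [CompleteSpace X]
    [NormedAddCommGroup Y] [InnerProductSpace ℝ Y] [CompleteSpace Y]
    (N : ℕ) (hN : 1 ≤ N)
    (F : ℕ → X → Y) (F' : ℕ → X → (X →L[ℝ] Y))
    (hFcont : ∀ i < N, Continuous (F i)) (hF'cont : ∀ i < N, Continuous (F' i))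
    (x₀ xstar : X) (ρ C η : ℝ) (hρ : 0 < ρ) (hC : 0 < C) (hη0 : 0 ≤ η) (hη1 : η < 1)
    (hA1 : ∀ i < N, ∀ x ∈ closedBall x₀ ρ, ‖F' i x‖ ≤ C)
    (hA2 : ∀ i < N, ∀ x ∈ closedBall x₀ ρ, ∀ x' ∈ closedBall x₀ ρ,
        ‖F i x' - F i x - F' i x (x' - x)‖ ≤ η * ‖F i x' - F i x‖)
    (y : ℕ → Y) (hA3 : xstar ∈ closedBall x₀ (ρ / 2)) (hsol : ∀ i < N, F i xstar = y i)
    (q α τ : ℝ) (hq0 : 0 < q) (hq1 : q < 1)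
    (hα : C ^ 2 * q / (1 - q) < α)
    (hτ : (1 + η) / (1 - η) < τ) (hqτ : η + (1 + η) / τ < q)
    -- the noise levels δ_j (with components δs j i > 0), converging to zero
    (δs : ℕ → ℕ → ℝ) (hδs_pos : ∀ j, ∀ i < N, 0 < δs j i)
    (hδs_lim : ∀ i < N, Tendsto (fun j => δs j i) atTop (nhds 0))
    -- the corresponding noisy data y^{δ_j}
    (ys : ℕ → ℕ → Y) (hys : ∀ j, ∀ i < N, ‖ys j i - y i‖ ≤ δs j i)
    -- the l-LMK iterates x_k^{δ_j} computed with data y^{δ_j} and noise levels δ_j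
    (xs hs : ℕ → ℕ → X) (ωs : ℕ → ℕ → ℝ)
    (hxs0 : ∀ j, xs j 0 = x₀)
    (hωs : ∀ j k, ωs j k =
        if τ * δs j (k % N) ≤ ‖F (k % N) (xs j k) - ys j (k % N)‖ then 1 else 0)
    (hhs : ∀ j k,
        ContinuousLinearMap.adjoint (F' (k % N) (xs j k)) (F' (k % N) (xs j k) (hs j k))
          + α • hs j k
        = ContinuousLinearMap.adjoint (F' (k % N) (xs j k))
            (ys j (k % N) - F (k % N) (xs j k)))
    (hrecs : ∀ j k, xs j (k + 1) = xs j k + ωs j k • hs j k)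
    -- the stopping indices k*^j = (l j) * N : the smallest multiple of N starting a
    -- cycle on which the iterates are constant
    (l : ℕ → ℕ)
    (hl : ∀ j, ∀ m ≤ N, xs j (l j * N + m) = xs j (l j * N))
    (hlmin : ∀ j, ∀ l' : ℕ, (∀ m ≤ N, xs j (l' * N + m) = xs j (l' * N)) → l j ≤ l')
    :
    ∃ xp : X, Tendsto (fun j => xs j (l j * N)) atTop (nhds xp) ∧
      ∀ i < N, F i xp = y i := by
  have hα0 : 0 < α := lt_of_le_of_lt (div_nonneg (by positivity) (by linarith)) hα
  have hmod : ∀ k, k % N < N := fun k => Nat.mod_lt _ hN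
  have hτ0 : 0 < τ := lt_trans (div_pos (by linarith) (by linarith)) hτ
  have hηq : η < q := lt_of_le_of_lt (le_add_of_nonneg_right (by positivity)) hqτ
  have hys_lim : ∀ i < N, Tendsto (fun j => ys j i) atTop (nhds (y i)) := fun i hi =>
    tendsto_iff_norm_sub_tendsto_zero.2
      (squeeze_zero (fun _ => norm_nonneg _) (fun j => hys j i hi) (hδs_lim i hi))
  choose H hH using fun (k : ℕ) (u : X) => exists_adjoint_apply_add_smul_eq (F' (k % N) u) hα0
    (ContinuousLinearMap.adjoint (F' (k % N) u) (y (k % N) - F (k % N) u))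
  let x : ℕ → X := fun k => Nat.rec x₀ (fun k u => u + H k u) k
  have hx : ∀ k, x (k + 1) = x k + H k (x k) := fun _ => rfl
  obtain ⟨xp, hxp, hlim, hxpsol⟩ := exists_tendsto_cycle_of_exact_data hN hFcont hη0 hη1 hA1 hA2
    hA3 hsol hq0 hq1 hηq hα (x := x) (h := fun k => H k (x k)) rfl (fun k => hH k (x k)) hx
  have hstable : ∀ k, Tendsto (fun j => xs j k) atTop (nhds (x k)) := by
    intro k
    induction k with
    | zero => simp only [hxs0]; exact tendsto_const_nhds
    | succ k ih =>
      have hFlim := ((hFcont _ (hmod k)).tendsto (x k)).comp ih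
      have hrlim : Tendsto (fun j => ys j (k % N) - F (k % N) (xs j k)) atTop
          (nhds (y (k % N) - F (k % N) (x k))) := (hys_lim _ (hmod k)).sub hFlim
      have hhlim : Tendsto (fun j => hs j k) atTop (nhds (H k (x k))) :=
        tendsto_of_adjoint_apply_add_smul_eq hα0 (((hF'cont _ (hmod k)).tendsto (x k)).comp ih)
          hrlim (fun j => hhs j k) (hH k (x k))
      simp only [hrecs, hx]
      refine ih.add ?_
      by_cases hr : y (k % N) - F (k % N) (x k) = 0
      · have hH0 : H k (x k) = 0 := by
          have h1 := mul_norm_le_norm_adjoint_apply_add_smul (F' (k % N) (x k)) (α := α) (H k (x k))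
          rw [hH, hr, map_zero, norm_zero] at h1
          exact norm_le_zero_iff.1 (nonpos_of_mul_nonpos_right h1 hα0)
        rw [hH0] at hhlim ⊢
        refine squeeze_zero_norm (fun j => ?_) (by simpa using hhlim.norm)
        rw [hωs]
        split_ifs <;> simp
      · refine hhlim.congr' ?_
        have h1 : Tendsto (fun j => τ * δs j (k % N)) atTop (nhds 0) := by
          simpa using (hδs_lim _ (hmod k)).const_mul τ
        filter_upwards [h1.eventually_lt hrlim.norm (norm_pos_iff.2 hr)] with j hj
        rw [hωs, if_pos (by rw [norm_sub_rev]; exact hj.le), one_smul]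
  have hmono : ∀ xh ∈ closedBall x₀ ρ, (∀ i < N, F i xh = y i) → ∀ j k,
      xs j k ∈ closedBall x₀ ρ → ‖xs j (k + 1) - xh‖ ≤ ‖xs j k - xh‖ := by
    intro xh hxh hxhsol j k hk
    rw [hrecs, hωs]
    split_ifs with hω
    · rw [one_smul, add_sub_right_comm]
      set r := ys j (k % N) - F (k % N) (xs j k)
      have hωr : τ * δs j (k % N) ≤ ‖r‖ := by rwa [norm_sub_rev] at hω
      have h1 := norm_residual_add_apply_le hη0 (hA2 _ (hmod k) _ hk _ hxh) (ys j (k % N))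
      rw [hxhsol _ (hmod k)] at h1
      have h2 : ‖ys j (k % N) - y (k % N)‖ ≤ ‖r‖ / τ :=
        (hys j _ (hmod k)).trans ((le_div_iff₀' hτ0).2 hωr)
      have h3 : ‖r + F' (k % N) (xs j k) (xs j k - xh)‖ ≤ (η + (1 + η) / τ) * ‖r‖ := by
        refine h1.trans ?_
        have h6 : (η + (1 + η) / τ) * ‖r‖ = η * ‖r‖ + (1 + η) * (‖r‖ / τ) := by ring
        rw [h6]
        gcongr
      have h4 := norm_add_sq_le_of_adjoint_apply_add_smul_eq hα0 (hhs j k)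
        (hA1 _ (hmod k) _ hk) hq0 hq1 hα hqτ.le h3
      refine le_of_sq_le_sq (h4.trans (sub_le_self _ ?_)) (norm_nonneg _)
      have h5 : 0 ≤ q - (η + (1 + η) / τ) := by linarith
      positivity
    · simp
  have hd : dist xstar x₀ ≤ ρ / 2 := hA3
  have hball : ∀ u : X, ‖u - xstar‖ ≤ ρ / 2 → u ∈ closedBall x₀ ρ := by
    intro u hu
    rw [mem_closedBall]
    rw [← dist_eq_norm] at hu
    linarith [dist_triangle u xstar x₀]
  have hhalf : ∀ j k, ‖xs j k - xstar‖ ≤ ρ / 2 := by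
    intro j k
    induction k with
    | zero => rwa [hxs0, ← dist_eq_norm, dist_comm]
    | succ k ih =>
      exact (hmono xstar (hball _ (by simp; linarith)) hsol j k (hball _ ih)).trans ih
  have hanti : ∀ j, Antitone fun k => ‖xs j k - xp‖ := fun j =>
    antitone_nat_of_succ_le fun k => hmono xp hxp hxpsol j k (hball _ (hhalf j k))
  have hconst : ∀ j m, xs j (l j * N + m) = xs j (l j * N) := by
    intro j m
    induction m with
    | zero => rfl
    | succ m ih =>
      have hm : (l j * N + m) % N = m % N := Nat.mul_add_mod_self_right _ _ _
      have hm' : (l j * N + m % N) % N = m % N := by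
        rw [Nat.mul_add_mod_self_right, Nat.mod_mod]
      have hx' := hl j (m % N) (hmod m).le
      have hstep := hl j (m % N + 1) (hmod m)
      rw [← add_assoc, hrecs, hx'] at hstep
      have hω' : ωs j (l j * N + m) = ωs j (l j * N + m % N) := by
        rw [hωs, hωs, hm, hm', ih, hx']
      have hh' : hs j (l j * N + m) = hs j (l j * N + m % N) := by
        have h1 := hhs j (l j * N + m)
        have h2 := hhs j (l j * N + m % N)
        rw [hm, ih] at h1
        rw [hm', hx', ← h1] at h2
        have h3 := mul_norm_le_norm_adjoint_apply_add_smul (F' (m % N) (xs j (l j * N))) (α := α)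
          (hs j (l j * N + m) - hs j (l j * N + m % N))
        rw [map_sub, map_sub, smul_sub, sub_add_sub_comm, h2, sub_self, norm_zero] at h3
        exact sub_eq_zero.1 (norm_le_zero_iff.1 (nonpos_of_mul_nonpos_right h3 hα0))
      rw [← add_assoc, hrecs, ih, hω', hh', hstep]
  have hfinal : ∀ j k, ‖xs j (l j * N) - xp‖ ≤ ‖xs j k - xp‖ := by
    intro j k
    rcases le_total k (l j * N) with hk | hk
    · exact hanti j hk
    · obtain ⟨m, rfl⟩ := Nat.exists_eq_add_of_le hk
      rw [hconst]
  refine ⟨xp, ?_, hxpsol⟩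
  rw [Metric.tendsto_atTop]
  intro ε hε
  obtain ⟨m, hm⟩ := (Metric.tendsto_nhds.1 hlim ε hε).exists
  obtain ⟨J, hJ⟩ := eventually_atTop.1
    (((hstable (m * N)).dist tendsto_const_nhds).eventually_lt_const hm)
  refine ⟨J, fun j hj => lt_of_le_of_lt ?_ (hJ j hj)⟩
  rw [dist_eq_norm, dist_eq_norm]
  exact hfinal j (m * N)
end
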